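/- Let F be a finite field, s, n natural numbers, and a, a′ ∈ F^s with a ≠ a′. If G is uniformly distributed over the s × n matrices with entries in F and d is uniformly distributed over Fⁿ, independently of G, then the pair (a G + d, a′ G + d) is uniformly distributed over Fⁿ × Fⁿ, where a G denotes the product of the row vector a with the matrix G. In particular, any two distinct codewords of a random coset code are uniformly distributed and statistically independent. -/

import Mathlib

/-- A surjective homomorphism of finite additive groups maps the uniform distribution to the
uniform distribution. -/
theorem PMF.map_uniformOfFintype_of_surjective {A B : Type*} [AddGroup A] [AddGroup B]
    [Fintype A] [Fintype B] (f : A →+ B) (hf : Function.Surjective f) :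
    (PMF.uniformOfFintype A).map f = PMF.uniformOfFintype B := by
  classical
  ext b
  have hcard : Fintype.card A = Fintype.card B * Finset.card {x : A | f x = b} := by
    rw [← Finset.card_univ, Finset.card_eq_sum_card_fiberwise (f := f) (t := Finset.univ) (by simp),
      Finset.sum_congr rfl fun c _ => AddMonoidHom.card_fiber_eq_of_mem_range f (hf c) (hf b)]
    simp
  have hk : (Finset.card {x : A | f x = b} : ENNReal) ≠ 0 := by
    obtain ⟨x, hx⟩ := hf b
    exact_mod_cast (Finset.card_pos.2 ⟨x, by simpa using hx⟩).ne'
  rw [PMF.map_apply, tsum_fintype]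
  simp only [PMF.uniformOfFintype_apply, eq_comm (a := b)]
  rw [← Finset.sum_filter, Finset.sum_const, nsmul_eq_mul, hcard, Nat.cast_mul,
    ENNReal.mul_inv (Or.inr (ENNReal.natCast_ne_top _)) (Or.inr hk), mul_left_comm,
    ENNReal.mul_inv_cancel hk (ENNReal.natCast_ne_top _), mul_one]

/-- The pair of codewords of two distinct messages takes every value as the generator matrix and
the shift vary. -/
theorem Matrix.surjective_vecMul_add_pair {F m n : Type*} [Field F] [Fintype m]
    {a a' : m → F} (ha : a ≠ a') :
    Function.Surjective fun Gd : Matrix m n F × (n → F) =>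
      (Matrix.vecMul a Gd.1 + Gd.2, Matrix.vecMul a' Gd.1 + Gd.2) := by
  classical
  rintro ⟨x, y⟩
  obtain ⟨i, hi⟩ := Function.ne_iff.1 ha
  have hi' : a i - a' i ≠ 0 := sub_ne_zero.2 hi
  refine ⟨(Matrix.of fun j k => if j = i then (a i - a' i)⁻¹ * (x k - y k) else 0,
    fun k => x k - a i * ((a i - a' i)⁻¹ * (x k - y k))), ?_⟩
  ext k
  · simp [Matrix.vecMul, dotProduct]
  · simp only [Matrix.vecMul, dotProduct, Pi.add_apply, Matrix.of_apply, mul_ite, mul_zero,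
      Finset.sum_ite_eq', Finset.mem_univ, if_true]
    field_simp
    ring

/-- For a random coset code (generator matrix `G` and shift `d` picked
independently and uniformly), any two distinct codewords `a G + d`,
`a' G + d` (with `a ≠ a'`) are jointly uniformly distributed on `Fⁿ × Fⁿ`,
hence uniform and independent. -/
theorem stmt9 (F : Type*) [Field F] [Fintype F] [DecidableEq F] (s n : ℕ)
    (a a' : Fin s → F) (ha : a ≠ a') :
    (PMF.uniformOfFintype (Matrix (Fin s) (Fin n) F × (Fin n → F))).map
        (fun Gd => (Matrix.vecMul a Gd.1 + Gd.2, Matrix.vecMul a' Gd.1 + Gd.2))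
      = PMF.uniformOfFintype ((Fin n → F) × (Fin n → F)) :=
  PMF.map_uniformOfFintype_of_surjective
    (AddMonoidHom.mk' (fun Gd : Matrix (Fin s) (Fin n) F × (Fin n → F) =>
      (Matrix.vecMul a Gd.1 + Gd.2, Matrix.vecMul a' Gd.1 + Gd.2)) fun u v => by
        simp only [Prod.fst_add, Prod.snd_add, Matrix.vecMul_add, Prod.mk_add_mk,
          add_add_add_comm])
    (Matrix.surjective_vecMul_add_pair ha)
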